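/- Let μ, ν ∈ P_1(ℝ) with μ ≤cx ν and let I, k ≥ 1 be integers. Then (1/I) Σ_{i=1}^I δ_{a_i} ≤cx (1/(kI)) Σ_{j=1}^{kI} δ_{b_j}, where a_i = I ∫_{(i−1)/I}^{i/I} F_μ^{-1}(u) du and b_j = kI ∫_{(j−1)/(kI)}^{j/(kI)} F_ν^{-1}(u) du. -/

import Mathlib

open MeasureTheory ProbabilityTheory Set
open scoped ENNReal

noncomputable section

/-- `μ ≤cx ν`: convex order between measures on a normed space. -/
def ConvexOrder {E : Type*} [NormedAddCommGroup E] [NormedSpace ℝ E] [MeasurableSpace E]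
    (μ ν : Measure E) : Prop :=
  (∀ φ : E → ℝ, ConvexOn ℝ univ φ → (∀ x, 0 ≤ φ x) →
      ∫⁻ x, ENNReal.ofReal (φ x) ∂μ ≤ ∫⁻ x, ENNReal.ofReal (φ x) ∂ν) ∧
  (∀ φ : E → ℝ, ConvexOn ℝ univ φ → Integrable φ (μ + ν) →
      ∫ x, φ x ∂μ ≤ ∫ x, φ x ∂ν)

/-- The quantile function `F_η^{-1}(p) = inf {x : F_η(x) ≥ p}` of a measure on `ℝ`. -/
def quantileFn (η : Measure ℝ) (p : ℝ) : ℝ :=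
  sInf {x : ℝ | p ≤ (η (Iic x)).toReal}

lemma quantile_le_iff (η : Measure ℝ) [IsProbabilityMeasure η] {p : ℝ} (hp : p ∈ Ioo (0:ℝ) 1)
    (x : ℝ) : quantileFn η p ≤ x ↔ p ≤ (η (Iic x)).toReal := by
  have hF : ∀ y, (η (Iic y)).toReal = cdf η y := fun y => by
    rw [cdf_eq_real]; rfl
  unfold quantileFn
  simp only [hF]
  set S : Set ℝ := {x : ℝ | p ≤ cdf η x} with hS
  have hne : S.Nonempty := by
    have := (tendsto_cdf_atTop η).eventually (lt_mem_nhds hp.2)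
    obtain ⟨y, hy⟩ := this.exists
    exact ⟨y, hy.le⟩
  have hbdd : BddBelow S := by
    have := (tendsto_cdf_atBot η).eventually (gt_mem_nhds hp.1)
    obtain ⟨y, hy⟩ := this.exists
    refine ⟨y, fun z hz => ?_⟩
    by_contra! h
    have h1 := monotone_cdf η h.le
    have h2 : p ≤ cdf η z := hz
    linarith
  have hmem : sInf S ∈ S := by
    have h1 : Filter.Tendsto (cdf η) (nhdsWithin (sInf S) (Ioi (sInf S))) (nhds (cdf η (sInf S))) :=
      ((cdf η).right_continuous (sInf S)).mono Ioi_subset_Ici_self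
    refine ge_of_tendsto h1 ?_
    filter_upwards [self_mem_nhdsWithin] with y hy
    obtain ⟨z, hz, hzy⟩ := exists_lt_of_csInf_lt hne hy
    exact le_trans hz (monotone_cdf η hzy.le)
  constructor
  · intro h
    exact le_trans hmem (monotone_cdf η h)
  · intro h
    exact csInf_le hbdd h

lemma quantile_mono (η : Measure ℝ) [IsProbabilityMeasure η] :
    MonotoneOn (quantileFn η) (Ioo 0 1) := by
  intro p hp q hq hpq
  rw [quantile_le_iff η hp]
  exact hpq.trans ((quantile_le_iff η hq _).1 le_rfl)

lemma quantile_aemeas (η : Measure ℝ) [IsProbabilityMeasure η] :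
    AEMeasurable (quantileFn η) (volume.restrict (Ioo 0 1)) :=
  aemeasurable_restrict_of_monotoneOn measurableSet_Ioo (quantile_mono η)

lemma quantile_map (η : Measure ℝ) [IsProbabilityMeasure η] :
    (volume.restrict (Ioo (0:ℝ) 1)).map (quantileFn η) = η := by
  symm
  refine Measure.ext_of_Iic _ _ fun x => ?_
  rw [Measure.map_apply_of_aemeasurable (quantile_aemeas η) measurableSet_Iic]
  have h1 : (quantileFn η ⁻¹' Iic x) =ᵐ[volume.restrict (Ioo (0:ℝ) 1)]
      Iic ((η (Iic x)).toReal) := by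
    rw [Filter.eventuallyEq_set]
    filter_upwards [ae_restrict_mem measurableSet_Ioo] with p hp
    exact quantile_le_iff η hp x
  rw [measure_congr h1, Measure.restrict_congr_set Ioo_ae_eq_Ioc,
    Measure.restrict_apply measurableSet_Iic]
  have h2 : Iic ((η (Iic x)).toReal) ∩ Ioc 0 1 = Ioc 0 ((η (Iic x)).toReal) := by
    have : (η (Iic x)).toReal ≤ 1 := by
      have := @prob_le_one _ _ η _ (Iic x)
      exact ENNReal.toReal_le_of_le_ofReal zero_le_one (by simpa using this)
    ext u
    simp only [mem_inter_iff, mem_Iic, mem_Ioc]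
    constructor
    · rintro ⟨a, b, c⟩; exact ⟨b, a⟩
    · rintro ⟨a, b⟩; exact ⟨b, a, b.trans this⟩
  rw [h2, Real.volume_Ioc, sub_zero, ENNReal.ofReal_toReal (measure_ne_top _ _)]

lemma quantile_integral (η : Measure ℝ) [IsProbabilityMeasure η] (f : ℝ → ℝ) (hf : Continuous f) :
    ∫ x, f x ∂η = ∫ u in (0:ℝ)..1, f (quantileFn η u) := by
  rw [intervalIntegral.integral_of_le zero_le_one, ← integral_Ioc_eq_integral_Ioo.symm]
  conv_lhs => rw [← quantile_map η]
  rw [integral_map (quantile_aemeas η) hf.aestronglyMeasurable]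

lemma quantile_integrable (η : Measure ℝ) [IsProbabilityMeasure η] (f : ℝ → ℝ) (hf : Continuous f)
    (hi : Integrable f η) : IntervalIntegrable (fun u => f (quantileFn η u)) volume 0 1 := by
  rw [intervalIntegrable_iff_integrableOn_Ioo_of_le zero_le_one]
  rw [← quantile_map η] at hi
  exact (integrable_map_measure hf.aestronglyMeasurable (quantile_aemeas η)).1 hi

lemma sub_int {f : ℝ → ℝ} (h : IntervalIntegrable f volume 0 1) {a b : ℝ}
    (ha : a ∈ Icc (0:ℝ) 1) (hb : b ∈ Icc (0:ℝ) 1) : IntervalIntegrable f volume a b := by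
  apply h.mono_set
  rw [uIcc_of_le (zero_le_one)]
  exact (convex_Icc (0:ℝ) 1).ordConnected.uIcc_subset ha hb

lemma integrable_id_of_abs {η : Measure ℝ} (h : Integrable (fun x => |x|) η) :
    Integrable (fun x : ℝ => x) η :=
  (integrable_norm_iff (by fun_prop)).1 h

lemma convexOrder_mean (μ ν : Measure ℝ) [IsProbabilityMeasure μ] [IsProbabilityMeasure ν]
    (hμ : Integrable (fun x : ℝ => x) μ) (hν : Integrable (fun x : ℝ => x) ν)
    (hcx : ConvexOrder μ ν) :
    ∫ u in (0:ℝ)..1, quantileFn μ u = ∫ u in (0:ℝ)..1, quantileFn ν u := by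
  have e1 := quantile_integral μ (fun x => x) continuous_id
  have e2 := quantile_integral ν (fun x => x) continuous_id
  rw [← e1, ← e2]
  have h1 := hcx.2 (fun x => x) (convexOn_id convex_univ) (hμ.add_measure hν)
  have h2 := hcx.2 (fun x => -x) (concaveOn_id convex_univ).neg (hμ.add_measure hν).neg
  rw [integral_neg, integral_neg] at h2
  linarith

lemma convexOrder_partial (μ ν : Measure ℝ) [IsProbabilityMeasure μ] [IsProbabilityMeasure ν]
    (hμ : Integrable (fun x : ℝ => x) μ) (hν : Integrable (fun x : ℝ => x) ν)
    (hcx : ConvexOrder μ ν) {p : ℝ} (hp : p ∈ Ioo (0:ℝ) 1) :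
    ∫ u in (0:ℝ)..p, quantileFn ν u ≤ ∫ u in (0:ℝ)..p, quantileFn μ u := by
  set y := quantileFn ν p with hy
  let f : ℝ → ℝ := fun x => max (y - x) 0
  have hf : Continuous f := by fun_prop
  have hfc : ConvexOn ℝ univ f :=
    ((convexOn_const y convex_univ).sub (concaveOn_id convex_univ)).sup
      (convexOn_const 0 convex_univ)
  have hfμ : Integrable f μ := ((integrable_const y).sub hμ).pos_part
  have hfν : Integrable f ν := ((integrable_const y).sub hν).pos_part
  have h := hcx.2 f hfc (hfμ.add_measure hfν)
  rw [quantile_integral μ f hf, quantile_integral ν f hf] at h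
  have iμ := quantile_integrable μ f hf hfμ
  have iν := quantile_integrable ν f hf hfν
  have qμ := quantile_integrable μ _ continuous_id hμ
  have qν := quantile_integrable ν _ continuous_id hν
  simp only [id] at qμ qν
  have h0 : (0:ℝ) ∈ Icc (0:ℝ) 1 := by simp
  have h1 : (1:ℝ) ∈ Icc (0:ℝ) 1 := by simp
  have hp' : p ∈ Icc (0:ℝ) 1 := ⟨hp.1.le, hp.2.le⟩
  rw [← intervalIntegral.integral_add_adjacent_intervals (sub_int iμ h0 hp') (sub_int iμ hp' h1),
    ← intervalIntegral.integral_add_adjacent_intervals (sub_int iν h0 hp') (sub_int iν hp' h1)] at h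
  have a1 : ∫ u in p..1, f (quantileFn ν u) ≤ ∫ u in p..1, (0:ℝ) := by
    refine intervalIntegral.integral_mono_on_of_le_Ioo hp.2.le (sub_int iν hp' h1) (by simp) ?_
    intro u hu
    have := quantile_mono ν hp ⟨hp.1.trans hu.1, hu.2⟩ hu.1.le
    simp only [f, sup_le_iff, le_refl, and_true]
    linarith
  have a2 : ∫ u in (0:ℝ)..p, f (quantileFn ν u) ≤ ∫ u in (0:ℝ)..p, (y - quantileFn ν u) := by
    refine intervalIntegral.integral_mono_on_of_le_Ioo hp.1.le (sub_int iν h0 hp')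
      (intervalIntegrable_const.sub (sub_int qν h0 hp')) ?_
    intro u hu
    have := quantile_mono ν ⟨hu.1, hu.2.trans hp.2⟩ hp hu.2.le
    simp only [f, sup_le_iff, le_refl, true_and]
    linarith
  have a3 : 0 ≤ ∫ u in p..1, f (quantileFn μ u) :=
    intervalIntegral.integral_nonneg hp.2.le fun u _ => le_max_right _ _
  have a4 : ∫ u in (0:ℝ)..p, (y - quantileFn μ u) ≤ ∫ u in (0:ℝ)..p, f (quantileFn μ u) := by
    refine intervalIntegral.integral_mono_on_of_le_Ioo hp.1.le
      (intervalIntegrable_const.sub (sub_int qμ h0 hp')) (sub_int iμ h0 hp') ?_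
    intro u hu
    exact le_max_left _ _
  rw [intervalIntegral.integral_sub intervalIntegrable_const (sub_int qν h0 hp')] at a2
  rw [intervalIntegral.integral_sub intervalIntegrable_const (sub_int qμ h0 hp')] at a4
  simp only [intervalIntegral.integral_zero] at a1
  linarith

lemma exists_subgradient {φ : ℝ → ℝ} (h : ConvexOn ℝ univ φ) :
    ∃ s : ℝ → ℝ, Monotone s ∧ ∀ x y, φ x + s x * (y - x) ≤ φ y := by
  have hm := h.monotoneOn_rightDeriv
  rw [interior_univ] at hm
  refine ⟨fun x => derivWithin φ (Ioi x) x, fun x y hxy => hm (mem_univ _) (mem_univ _) hxy, ?_⟩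
  intro x y
  rcases lt_trichotomy x y with hxy | hxy | hxy
  · have := h.rightDeriv_le_slope_of_mem_interior (by simp) (mem_univ y) hxy
    rw [slope_def_field, le_div_iff₀ (by linarith)] at this
    linarith
  · simp [hxy]
  · have h1 := h.leftDeriv_le_rightDeriv_of_mem_interior (x := x) (by simp)
    have h2 := h.slope_le_leftDeriv_of_mem_interior (mem_univ y) (y := x) (by simp) hxy
    have h3 := h2.trans h1
    rw [slope_def_field, div_le_iff₀ (by linarith)] at h3
    linarith

lemma abel_ineq (s d : ℕ → ℝ) (n : ℕ) (hs : ∀ i < n, s i ≤ s (i + 1))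
    (hD : ∀ i < n, ∑ j ∈ Finset.range (i + 1), d j ≤ 0) :
    s n * ∑ j ∈ Finset.range (n + 1), d j ≤ ∑ j ∈ Finset.range (n + 1), s j * d j := by
  induction n with
  | zero => simp
  | succ n ih =>
    have h1 := ih (fun i hi => hs i (by omega)) (fun i hi => hD i (by omega))
    have h2 := hs n (by omega)
    have h3 := hD n (by omega)
    rw [Finset.sum_range_succ, Finset.sum_range_succ _ (n + 1)]
    nlinarith

lemma sum_range_block (f : ℕ → ℝ) (k n : ℕ) :
    ∑ j ∈ Finset.range (k * n), f j = ∑ i ∈ Finset.range n, ∑ r ∈ Finset.range k, f (k * i + r) := by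
  induction n with
  | zero => simp
  | succ n ih => rw [Nat.mul_succ, Finset.sum_range_add, ih, Finset.sum_range_succ]

lemma integrable_avg (n : ℕ) (hn : 1 ≤ n) (a : ℕ → ℝ) (φ : ℝ → ℝ) :
    Integrable φ ((n : ℝ≥0∞)⁻¹ • ∑ i ∈ Finset.range n, Measure.dirac (a i)) := by
  apply Integrable.smul_measure
  · exact integrable_finsetSum_measure.2 fun i _ => integrable_dirac (by simp)
  · simp; omega

lemma integral_avg (n : ℕ) (a : ℕ → ℝ) (φ : ℝ → ℝ) :
    ∫ x, φ x ∂((n : ℝ≥0∞)⁻¹ • ∑ i ∈ Finset.range n, Measure.dirac (a i))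
      = (n : ℝ)⁻¹ * ∑ i ∈ Finset.range n, φ (a i) := by
  rw [integral_smul_measure, integral_finsetSum_measure]
  · simp
  · exact fun i _ => integrable_dirac (by simp)

lemma convexOrder_avg (n m : ℕ) (hn : 1 ≤ n) (hm : 1 ≤ m) (a b : ℕ → ℝ)
    (h : ∀ φ : ℝ → ℝ, ConvexOn ℝ univ φ → (n : ℝ)⁻¹ * ∑ i ∈ Finset.range n, φ (a i)
      ≤ (m : ℝ)⁻¹ * ∑ i ∈ Finset.range m, φ (b i)) :
    ConvexOrder ((n : ℝ≥0∞)⁻¹ • ∑ i ∈ Finset.range n, Measure.dirac (a i))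
      ((m : ℝ≥0∞)⁻¹ • ∑ i ∈ Finset.range m, Measure.dirac (b i)) := by
  constructor
  · intro φ hφ h0
    rw [← ofReal_integral_eq_lintegral_ofReal (integrable_avg n hn a φ) (Filter.Eventually.of_forall h0),
      ← ofReal_integral_eq_lintegral_ofReal (integrable_avg m hm b φ) (Filter.Eventually.of_forall h0),
      integral_avg, integral_avg]
    exact ENNReal.ofReal_le_ofReal (h φ hφ)
  · intro φ hφ _
    rw [integral_avg, integral_avg]
    exact h φ hφ

lemma grid_mem {n i : ℕ} (hn : 1 ≤ n) (hi : i ≤ n) : (i : ℝ) / n ∈ Icc (0:ℝ) 1 := by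
  have : (0:ℝ) < n := by exact_mod_cast hn
  refine ⟨by positivity, ?_⟩
  rw [div_le_one this]; exact_mod_cast hi

lemma grid_mono {q : ℝ → ℝ} (hq : IntervalIntegrable q volume 0 1) (hm : MonotoneOn q (Ioo 0 1))
    {n i : ℕ} (hi : i + 1 < n) :
    ∫ u in ((i:ℝ) / n)..(((i:ℝ) + 1) / n), q u ≤
      ∫ u in (((i + 1 : ℕ):ℝ) / n)..((((i + 1 : ℕ):ℝ) + 1) / n), q u := by
  have hn : (0:ℝ) < n := by exact_mod_cast (by omega : 0 < n)
  have m0 := grid_mem (n := n) (i := i) (by omega) (by omega)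
  have m1 := grid_mem (n := n) (i := i + 1) (by omega) (by omega)
  have m2 := grid_mem (n := n) (i := i + 2) (by omega) (by omega)
  set p : ℝ := ((i + 1 : ℕ) : ℝ) / n with hpdef
  have e1 : ((i:ℝ) + 1) / n = p := by rw [hpdef]; push_cast; rfl
  have e2 : (((i + 1 : ℕ):ℝ) + 1) / n = ((i + 2 : ℕ) : ℝ) / n := by push_cast; ring
  have hp : p ∈ Ioo (0:ℝ) 1 := by
    refine ⟨by positivity, ?_⟩
    rw [hpdef, div_lt_one hn]; exact_mod_cast hi
  have l1 : (i:ℝ) / n ≤ p := by rw [hpdef]; gcongr; omega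
  have l2 : p ≤ ((i + 2 : ℕ):ℝ) / n := by rw [hpdef]; gcongr; omega
  rw [e1, e2]
  have h1 : ∫ u in ((i:ℝ) / n)..p, q u ≤ ∫ u in ((i:ℝ) / n)..p, q p :=
    intervalIntegral.integral_mono_on_of_le_Ioo l1 (sub_int hq m0 m1) (by simp)
      fun u hu => hm ⟨m0.1.trans_lt hu.1, hu.2.trans hp.2⟩ hp hu.2.le
  have h2 : ∫ u in p..(((i + 2 : ℕ):ℝ) / n), q p ≤ ∫ u in p..(((i + 2 : ℕ):ℝ) / n), q u :=
    intervalIntegral.integral_mono_on_of_le_Ioo l2 (by simp) (sub_int hq m1 m2)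
      fun u hu => hm hp ⟨hp.1.trans hu.1, hu.2.trans_le m2.2⟩ hu.1.le
  refine h1.trans (le_trans (le_of_eq ?_) h2)
  simp only [intervalIntegral.integral_const, smul_eq_mul, hpdef]
  push_cast
  ring

lemma grid_sum {q : ℝ → ℝ} (hq : IntervalIntegrable q volume 0 1) {n : ℕ} (hn : 1 ≤ n) (c m : ℕ)
    (hm : c + m ≤ n) :
    ∑ r ∈ Finset.range m, ∫ u in (((c + r : ℕ):ℝ) / n)..((((c + r : ℕ):ℝ) + 1) / n), q u
      = ∫ u in ((c:ℝ) / n)..(((c + m : ℕ):ℝ) / n), q u := by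
  have := intervalIntegral.sum_integral_adjacent_intervals (f := q) (μ := volume) (n := m)
    (a := fun r => ((c + r : ℕ):ℝ) / n)
    (fun r hr => sub_int hq (grid_mem hn (by omega)) (grid_mem hn (by omega)))
  simp only [add_zero] at this
  rw [← this]
  refine Finset.sum_congr rfl fun r _ => ?_
  push_cast
  simp only [add_assoc]

/-- if `μ, ν ∈ P_1(ℝ)` with `μ ≤cx ν` and `I, k ≥ 1`, then
`(1/I) Σ_{i=1}^I δ_{a_i} ≤cx (1/(kI)) Σ_{j=1}^{kI} δ_{b_j}` where
`a_i = I ∫_{(i-1)/I}^{i/I} F_μ^{-1}(u) du` and `b_j = kI ∫_{(j-1)/(kI)}^{j/(kI)} F_ν^{-1}(u) du`. -/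
theorem stmt8 (μ ν : Measure ℝ)
    [IsProbabilityMeasure μ] [IsProbabilityMeasure ν]
    (hμ1 : Integrable (fun x => |x|) μ) (hν1 : Integrable (fun x => |x|) ν)
    (hcx : ConvexOrder μ ν) (I k : ℕ) (hI : 1 ≤ I) (hk : 1 ≤ k) :
    ConvexOrder
      ((I : ℝ≥0∞)⁻¹ • ∑ i ∈ Finset.range I,
        Measure.dirac ((I : ℝ) * ∫ u in ((i : ℝ) / I)..(((i : ℝ) + 1) / I), quantileFn μ u))
      (((k * I : ℕ) : ℝ≥0∞)⁻¹ • ∑ j ∈ Finset.range (k * I),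
        Measure.dirac (((k * I : ℕ) : ℝ) *
          ∫ u in ((j : ℝ) / (k * I : ℕ))..(((j : ℝ) + 1) / (k * I : ℕ)), quantileFn ν u)) := by
  have hμ := integrable_id_of_abs hμ1
  have hν := integrable_id_of_abs hν1
  have qμ : IntervalIntegrable (quantileFn μ) volume 0 1 :=
    quantile_integrable μ _ continuous_id hμ
  have qν : IntervalIntegrable (quantileFn ν) volume 0 1 :=
    quantile_integrable ν _ continuous_id hν
  have hkI : 1 ≤ k * I := Nat.mul_pos hk hI
  refine convexOrder_avg I (k * I) hI hkI
    (fun i => (I : ℝ) * ∫ u in ((i : ℝ) / I)..(((i : ℝ) + 1) / I), quantileFn μ u)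
    (fun j => ((k * I : ℕ) : ℝ) *
          ∫ u in ((j : ℝ) / (k * I : ℕ))..(((j : ℝ) + 1) / (k * I : ℕ)), quantileFn ν u) ?_
  intro φ hφ
  have hI0 : (0:ℝ) < I := by exact_mod_cast hI
  have hk0 : (0:ℝ) < k := by exact_mod_cast hk
  set A : ℕ → ℝ := fun i => ∫ u in ((i : ℝ) / I)..(((i : ℝ) + 1) / I), quantileFn μ u with hA
  set C : ℕ → ℝ := fun i => ∫ u in ((i : ℝ) / I)..(((i : ℝ) + 1) / I), quantileFn ν u with hC
  set B : ℕ → ℝ := fun j =>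
    ∫ u in ((j : ℝ) / (k * I : ℕ))..(((j : ℝ) + 1) / (k * I : ℕ)), quantileFn ν u with hB
  change (I : ℝ)⁻¹ * ∑ i ∈ Finset.range I, φ (I * A i) ≤
    ((k * I : ℕ) : ℝ)⁻¹ * ∑ j ∈ Finset.range (k * I), φ (((k * I : ℕ) : ℝ) * B j)
  have hBC : ∀ i < I, ∑ r ∈ Finset.range k, B (k * i + r) = C i := by
    intro i hi
    have hle : k * i + k ≤ k * I := by
      have := Nat.mul_le_mul_left k (Nat.succ_le_of_lt hi)
      rwa [Nat.mul_succ] at this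
    have := grid_sum qν hkI (k * i) k hle
    simp only [hB, hC]
    rw [this]
    congr 1
    · push_cast; field_simp
    · push_cast; field_simp
  have hD : ∀ m ≤ I, ∑ j ∈ Finset.range m, (C j - A j) =
      (∫ u in (0:ℝ)..((m:ℝ) / I), quantileFn ν u) - ∫ u in (0:ℝ)..((m:ℝ) / I), quantileFn μ u := by
    intro m hm
    have h1 := grid_sum qν hI 0 m (by omega)
    have h2 := grid_sum qμ hI 0 m (by omega)
    simp only [zero_add, Nat.cast_zero, zero_div] at h1 h2
    rw [Finset.sum_sub_distrib, ← h1, ← h2]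
  obtain ⟨s, hs, hsub⟩ := exists_subgradient hφ
  obtain ⟨n, rfl⟩ : ∃ n, I = n + 1 := ⟨I - 1, by omega⟩
  have key : 0 ≤ ∑ i ∈ Finset.range (n + 1), s ((n + 1 : ℕ) * A i) * (C i - A i) := by
    have h := abel_ineq (fun i => s ((n + 1 : ℕ) * A i)) (fun i => C i - A i) n ?_ ?_
    · rw [hD (n + 1) le_rfl, div_self hI0.ne', convexOrder_mean μ ν hμ hν hcx] at h
      simpa using h
    · intro i hi
      exact hs (mul_le_mul_of_nonneg_left (grid_mono qμ (quantile_mono μ) (by omega)) hI0.le)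
    · intro i hi
      rw [hD (i + 1) (by omega), sub_nonpos]
      apply convexOrder_partial μ ν hμ hν hcx
      refine ⟨by positivity, ?_⟩
      rw [div_lt_one hI0]; exact_mod_cast (by omega : i + 1 < n + 1)
  have block : ∀ i ∈ Finset.range (n + 1),
      k * φ ((n + 1 : ℕ) * A i) + (k * (n + 1 : ℕ)) * (s ((n + 1 : ℕ) * A i) * (C i - A i)) ≤
      ∑ r ∈ Finset.range k, φ (((k * (n + 1) : ℕ) : ℝ) * B (k * i + r)) := by
    intro i hi
    have h := Finset.sum_le_sum fun r (_ : r ∈ Finset.range k) =>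
      hsub ((n + 1 : ℕ) * A i) (((k * (n + 1) : ℕ) : ℝ) * B (k * i + r))
    refine le_trans (le_of_eq ?_) h
    rw [Finset.sum_add_distrib, ← Finset.mul_sum, Finset.sum_sub_distrib, ← Finset.mul_sum,
      hBC i (Finset.mem_range.1 hi)]
    simp only [Finset.sum_const, Finset.card_range, nsmul_eq_mul]
    push_cast
    ring
  have tot := Finset.sum_le_sum block
  rw [← sum_range_block (fun j => φ (((k * (n + 1) : ℕ) : ℝ) * B j)), Finset.sum_add_distrib,
    ← Finset.mul_sum, ← Finset.mul_sum] at tot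
  have tot2 : (k:ℝ) * ∑ i ∈ Finset.range (n + 1), φ ((n + 1 : ℕ) * A i) ≤
      ∑ j ∈ Finset.range (k * (n + 1)), φ (((k * (n + 1) : ℕ) : ℝ) * B j) :=
    le_trans (le_add_of_nonneg_right (by positivity)) tot
  calc _ = ((k * (n + 1) : ℕ) : ℝ)⁻¹ * ((k:ℝ) * ∑ i ∈ Finset.range (n + 1), φ ((n + 1 : ℕ) * A i)) := by
        rw [Nat.cast_mul]; field_simp
    _ ≤ _ := mul_le_mul_of_nonneg_left tot2 (by positivity)
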